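/- Let p ∈ ℂ with 2p ∉ Λ_τ, let A₀ = 3℘''(p)/(4℘'(p)), and define f(z) = e^{4ζ(p)z} σ(z−p)² / σ(z+p)². Then for every z ∈ ℂ ∖ S with f'(z) ≠ 0, the Schwarzian derivative of f satisfies {f; z} := (f''/f')' − (1/2)(f''/f')² = −2 q(z; A₀), where q is the potential with B = B(A₀). -/

import Mathlib

open Complex Filter Topology

noncomputable section

/-- The lattice `Λ_τ = ℤ + τℤ`. -/
def Lam (τ : ℂ) : Set ℂ := {ω | ∃ m n : ℤ, ω = (m : ℂ) + (n : ℂ) * τ}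

/-- The nonzero lattice points. -/
def Lam' (τ : ℂ) : Set ℂ := {ω | ω ∈ Lam τ ∧ ω ≠ 0}

/-- The Weierstrass elliptic function `℘(z; τ)`. -/
def wp (τ z : ℂ) : ℂ :=
  1 / z ^ 2 + ∑' ω : Lam' τ, (1 / (z - (ω : ℂ)) ^ 2 - 1 / (ω : ℂ) ^ 2)

/-- The Weierstrass zeta function `ζ(z; τ)`. -/
def wzeta (τ z : ℂ) : ℂ :=
  1 / z + ∑' ω : Lam' τ, (1 / (z - (ω : ℂ)) + 1 / (ω : ℂ) + z / (ω : ℂ) ^ 2)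

/-- The Weierstrass sigma function `σ(z; τ)`. -/
def wsigma (τ z : ℂ) : ℂ :=
  z * ∏' ω : Lam' τ,
    ((1 - z / (ω : ℂ)) * Complex.exp (z / (ω : ℂ) + z ^ 2 / (2 * (ω : ℂ) ^ 2)))

/-- `℘'(z; τ)`. -/
def wpd (τ : ℂ) : ℂ → ℂ := deriv (wp τ)

/-- `℘''(z; τ)`. -/
def wpdd (τ : ℂ) : ℂ → ℂ := deriv (deriv (wp τ))

/-- The constant `B(A)`. -/
def Bc (τ p A : ℂ) : ℂ :=
  A ^ 2 - wzeta τ (2 * p) * A - 3 / 4 * wp τ (2 * p) - 2 * wp τ p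

/-- The potential `q(z; A)`. -/
def qpot (τ p A z : ℂ) : ℂ :=
  2 * wp τ z + 3 / 4 * (wp τ (z + p) + wp τ (z - p))
    + A * (wzeta τ (z + p) - wzeta τ (z - p)) + Bc τ p A

/-- The singular set `S = Λ_τ ∪ (p + Λ_τ) ∪ (−p + Λ_τ)`. -/
def Sset (τ p : ℂ) : Set ℂ :=
  Lam τ ∪ {z | z - p ∈ Lam τ} ∪ {z | z + p ∈ Lam τ}

/-- The unique elliptic solution `Φ_e(z; A)` of the second symmetric product equation. -/
def Phie (τ p A z : ℂ) : ℂ :=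
  wp τ z + (A / 2 - 3 * wpdd τ p / (8 * wpd τ p)) * (wzeta τ (z + p) - wzeta τ (z - p))
    - A ^ 2 + (wpdd τ p / (2 * wpd τ p) - wzeta τ p) * A
    - wp τ p + 3 / 4 * (wpdd τ p / wpd τ p) * wzeta τ p
    + 3 / 16 * (wpdd τ p ^ 2 / wpd τ p ^ 2)

/-- The cubic factor `Y₁(A)`. -/
def Y1 (τ p A : ℂ) : ℂ :=
  A ^ 3 - 5 * wpdd τ p / (4 * wpd τ p) * A ^ 2
    + 3 * (wp τ p + wpdd τ p ^ 2 / (16 * wpd τ p ^ 2)) * A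
    + wpd τ p / 2 - 9 * wpdd τ p / (4 * wpd τ p) * wp τ p
    + 9 / 64 * (wpdd τ p ^ 3 / wpd τ p ^ 3)

/-- The cubic factor `Y₂(A)`. -/
def Y2 (τ p A : ℂ) : ℂ :=
  A ^ 3 - wpdd τ p / (4 * wpd τ p) * A ^ 2
    - 5 / 16 * (wpdd τ p ^ 2 / wpd τ p ^ 2) * A
    + 2 * wpd τ p - 3 / 64 * (wpdd τ p ^ 3 / wpd τ p ^ 3)

/-- The type II developing map `f(z) = e^{4ζ(p)z} σ(z−p)²/σ(z+p)²`. -/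
def fdev (τ p z : ℂ) : ℂ :=
  Complex.exp (4 * wzeta τ p * z) * wsigma τ (z - p) ^ 2 / wsigma τ (z + p) ^ 2

namespace PeriodPair

open Set

theorem countable_lattice (L : PeriodPair) : (L.lattice : Set ℂ).Countable := by
  have : Countable L.lattice := L.latticeEquivProd.toEquiv.countable_iff.mpr inferInstance
  exact this.to_set

/-- The Weierstrass `ζ`-function of a lattice with the singular term `1 / z` at `0` removed. -/
def weierstrassZetaReg (L : PeriodPair) (z : ℂ) : ℂ :=
  ∑' l : L.lattice, if l.1 = 0 then 0 else (1 / (z - l) + 1 / l + z / (l : ℂ) ^ 2)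

/-- The Weierstrass `ζ`-function of a lattice. -/
def weierstrassZeta (L : PeriodPair) (z : ℂ) : ℂ :=
  1 / z + L.weierstrassZetaReg z

theorem weierstrassZeta_bound {r : ℝ} (hr : 0 < r) {s : ℂ} (hs : ‖s‖ < r) {l : ℂ}
    (h : 2 * r ≤ ‖l‖) :
    ‖1 / (s - l) + 1 / l + s / l ^ 2‖ ≤ 2 * r ^ 2 * ‖l‖ ^ (-3 : ℝ) := by
  have hl : 0 < ‖l‖ := by linarith
  have hl0 : l ≠ 0 := norm_pos_iff.mp hl
  have hd : ‖l‖ / 2 ≤ ‖s - l‖ := by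
    rw [norm_sub_rev]
    exact .trans (by linarith) (norm_sub_norm_le l s)
  have hsl : s - l ≠ 0 := norm_pos_iff.mp (by linarith)
  have e : 1 / (s - l) + 1 / l + s / l ^ 2 = s ^ 2 / (l ^ 2 * (s - l)) := by
    field_simp
    ring
  rw [e, norm_div, norm_mul, norm_pow, norm_pow]
  calc ‖s‖ ^ 2 / (‖l‖ ^ 2 * ‖s - l‖) ≤ r ^ 2 / (‖l‖ ^ 2 * (‖l‖ / 2)) := by gcongr
    _ = 2 * r ^ 2 / ‖l‖ ^ 3 := by field
    _ = _ := by norm_cast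

theorem hasSumLocallyUniformly_weierstrassZetaReg (L : PeriodPair) :
    HasSumLocallyUniformly
      (fun (l : L.lattice) (z : ℂ) ↦
        if l.1 = 0 then 0 else (1 / (z - l) + 1 / l + z / (l : ℂ) ^ 2))
      L.weierstrassZetaReg := by
  refine L.hasSumLocallyUniformly_aux (u := (2 * · ^ 2 * ‖·‖ ^ (-3 : ℝ))) _
    (fun _ _ ↦ (ZLattice.summable_norm_rpow _ _ (by simp; norm_num)).mul_left _) fun r hr ↦
    Filter.eventually_atTop.mpr ⟨2 * r, ?_⟩
  rintro _ h s hs l rfl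
  split_ifs
  · simpa using! show 0 ≤ 2 * r ^ 2 * (‖(l : ℂ)‖ ^ 3)⁻¹ by positivity
  · exact weierstrassZeta_bound hr hs h

theorem hasDerivAt_weierstrassZetaReg_summand {l z : ℂ} (h : l ≠ 0 → z ≠ l) :
    HasDerivAt (fun z ↦ if l = 0 then 0 else (1 / (z - l) + 1 / l + z / l ^ 2))
      (-(if l = 0 then 0 else (1 / (z - l) ^ 2 - 1 / l ^ 2))) z := by
  split_ifs with hl
  · simpa using hasDerivAt_const z (0 : ℂ)
  · have hzl : z - l ≠ 0 := sub_ne_zero.mpr (h hl)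
    convert! ((((hasDerivAt_id z).sub_const l).inv hzl).add_const (1 / l)).add
      ((hasDerivAt_id z).div_const (l ^ 2)) using 1
    · ext w; simp
    · simp only [id]; ring

theorem hasDerivAt_weierstrassZetaReg (L : PeriodPair) {z : ℂ}
    (hz : z ∈ ((L.lattice : Set ℂ) \ {0})ᶜ) :
    HasDerivAt L.weierstrassZetaReg (-L.weierstrassPExcept 0 z) z := by
  have hsub : ∀ x ∈ ((L.lattice : Set ℂ) \ {0})ᶜ, ∀ l : L.lattice, (l : ℂ) ≠ 0 → x ≠ l := by
    rintro x hx l hl rfl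
    exact hx ⟨l.2, hl⟩
  have hdiff : ∀ᶠ s : Finset L.lattice in atTop, DifferentiableOn ℂ
      (fun z ↦ ∑ l ∈ s, if l.1 = 0 then 0 else (1 / (z - l) + 1 / l + z / (l : ℂ) ^ 2))
      ((L.lattice : Set ℂ) \ {0})ᶜ :=
    .of_forall fun s ↦ .fun_sum fun i _ x hx ↦
      (hasDerivAt_weierstrassZetaReg_summand (hsub x hx i)).differentiableAt.differentiableWithinAt
  have hloc := L.hasSumLocallyUniformly_weierstrassZetaReg.tendstoLocallyUniformlyOn
    (s := ((L.lattice : Set ℂ) \ {0})ᶜ)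
  have hd := (hloc.differentiableOn hdiff L.isOpen_compl_lattice_sdiff).differentiableAt
    (L.isOpen_compl_lattice_sdiff.mem_nhds hz)
  have h1 := (hloc.deriv hdiff L.isOpen_compl_lattice_sdiff).tendsto_at hz
  have h2 := (L.hasSum_weierstrassPExcept 0 z).neg
  have h3 : deriv L.weierstrassZetaReg z = -L.weierstrassPExcept 0 z := by
    refine tendsto_nhds_unique h1 (h2.congr fun s ↦ ?_)
    refine Eq.symm (HasDerivAt.deriv ?_)
    exact HasDerivAt.fun_sum fun i _ ↦ hasDerivAt_weierstrassZetaReg_summand (hsub z hz i)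
  exact h3 ▸ hd.hasDerivAt

theorem hasDerivAt_weierstrassZeta (L : PeriodPair) {z : ℂ} (hz : z ∉ L.lattice) :
    HasDerivAt L.weierstrassZeta (-L.weierstrassP z) z := by
  have hz0 : z ≠ 0 := by rintro rfl; exact hz L.lattice.zero_mem
  have h := L.hasDerivAt_weierstrassZetaReg (z := z) (fun h ↦ hz h.1)
  have e := L.weierstrassPExcept_add 0 z
  convert! (hasDerivAt_inv hz0).add h using 1
  · ext w; simp [weierstrassZeta]
  · rw [← e]; simp

theorem weierstrassZeta_neg (L : PeriodPair) (z : ℂ) :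
    L.weierstrassZeta (-z) = -L.weierstrassZeta z := by
  have : L.weierstrassZetaReg (-z) = -L.weierstrassZetaReg z := by
    simp only [weierstrassZetaReg]
    rw [← (Equiv.neg L.lattice).tsum_eq, ← tsum_neg]
    congr! 2 with l
    by_cases hl : (l : ℂ) = 0
    · simp [hl]
    · have : -z - -(l : ℂ) = -(z - l) := by ring
      simp only [Equiv.neg_apply, NegMemClass.coe_neg, neg_eq_zero, hl, if_false, this]
      rw [div_neg, div_neg]
      ring
  simp only [weierstrassZeta, this, div_neg]
  ring

theorem tendsto_mul_weierstrassZeta (L : PeriodPair) :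
    Tendsto (fun z ↦ z * L.weierstrassZeta z) (𝓝[≠] 0) (𝓝 1) := by
  have h : Tendsto (fun z ↦ 1 + z * L.weierstrassZetaReg z) (𝓝[≠] 0) (𝓝 1) := by
    have hc : ContinuousAt (fun z ↦ 1 + z * L.weierstrassZetaReg z) 0 := by
      have := (L.hasDerivAt_weierstrassZetaReg (z := 0) (by simp)).continuousAt
      fun_prop
    simpa using hc.tendsto.mono_left nhdsWithin_le_nhds
  refine h.congr' ?_
  filter_upwards [self_mem_nhdsWithin] with z hz
  have : z ≠ 0 := hz
  simp only [weierstrassZeta]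
  field_simp

theorem isPreconnected_compl_lattice (L : PeriodPair) :
    IsPreconnected (L.lattice : Set ℂ)ᶜ :=
  (L.countable_lattice.isConnected_compl_of_one_lt_rank
    (by simp [Complex.rank_real_complex])).isPreconnected

theorem add_mem_lattice_iff (L : PeriodPair) {z l : ℂ} (hl : l ∈ L.lattice) :
    z + l ∈ L.lattice ↔ z ∈ L.lattice :=
  L.lattice.add_mem_iff_left hl

/-- Quasi-periodicity of the Weierstrass `ζ`-function. -/
theorem exists_weierstrassZeta_add (L : PeriodPair) {l : ℂ} (hl : l ∈ L.lattice) :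
    ∃ η, ∀ z ∉ L.lattice, L.weierstrassZeta (z + l) = L.weierstrassZeta z + η := by
  have hd : ∀ z ∈ (L.lattice : Set ℂ)ᶜ,
      HasDerivAt (fun z ↦ L.weierstrassZeta (z + l) - L.weierstrassZeta z) 0 z := by
    intro z hz
    have h1 := (L.hasDerivAt_weierstrassZeta
      (z := z + l) ((L.add_mem_lattice_iff hl).not.mpr hz)).comp_add_const z l
    convert! h1.sub (L.hasDerivAt_weierstrassZeta hz) using 1
    simp [L.weierstrassP_add_coe z ⟨l, hl⟩]
  obtain ⟨η, hη⟩ := L.isClosed_lattice.isOpen_compl.exists_is_const_of_deriv_eq_zero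
    L.isPreconnected_compl_lattice
    (fun z hz ↦ (hd z hz).differentiableAt.differentiableWithinAt) (fun z hz ↦ (hd z hz).deriv)
  exact ⟨η, fun z hz ↦ by linear_combination hη z hz⟩

theorem compl_lattice_mem_nhdsNE (L : PeriodPair) (a x : ℂ) :
    ∀ᶠ z in 𝓝[≠] x, z + a ∉ L.lattice := by
  have h : ((L.lattice : Set ℂ) \ {x + a})ᶜ ∈ 𝓝 (x + a) :=
    L.compl_lattice_sdiff_singleton_mem_nhds _
  have h2 : ∀ᶠ z in 𝓝 x, z + a ∈ ((L.lattice : Set ℂ) \ {x + a})ᶜ :=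
    (continuous_add_const a).continuousAt.tendsto.eventually h
  filter_upwards [nhdsWithin_le_nhds h2, self_mem_nhdsWithin] with z hz hne hmem
  exact hz ⟨hmem, fun h ↦ hne (add_right_cancel h)⟩

/-- A doubly periodic function all of whose singularities are removable is constant. -/
theorem exists_tendsto_of_periodic (L : PeriodPair) {H : ℂ → ℂ} {c : ℂ → ℂ}
    (hd : ∀ x, ∀ᶠ z in 𝓝[≠] x, DifferentiableAt ℂ H z)
    (hper : ∀ l ∈ L.lattice, ∀ x, ∀ᶠ z in 𝓝[≠] x, H (z + l) = H z)
    (hc : ∀ x, Tendsto H (𝓝[≠] x) (𝓝 (c x))) (x y : ℂ) : c x = c y := by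
  have hcH : ∀ z, DifferentiableAt ℂ H z → c z = H z := fun z hz ↦
    tendsto_nhds_unique (hc z) (hz.continuousAt.tendsto.mono_left nhdsWithin_le_nhds)
  have heq : ∀ x, c =ᶠ[𝓝[≠] x] H := fun x ↦ (hd x).mono hcH
  have han : ∀ x, AnalyticAt ℂ c x := by
    intro x
    refine Complex.analyticAt_of_differentiable_on_punctured_nhds_of_continuousAt ?_ ?_
    · filter_upwards [hd x, eventually_eventually_nhdsWithin.mpr (heq x), self_mem_nhdsWithin]
        with z hz hz' hne
      refine hz.congr_of_eventuallyEq ?_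
      rwa [isOpen_compl_singleton.nhdsWithin_eq hne] at hz'
    · exact continuousAt_iff_punctured_nhds.mpr ((hc x).congr' (heq x).symm)
  have hdiff : Differentiable ℂ c := fun x ↦ (han x).differentiableAt
  have hcper : ∀ z, ∀ l ∈ L.lattice, c (z + l) = c z := by
    intro z l hl
    have ht : Tendsto (· + l) (𝓝[≠] z) (𝓝[≠] (z + l)) :=
      ((continuous_add_const l).tendsto z).inf (by simp)
    exact tendsto_nhds_unique (((hc (z + l)).comp ht).congr' (hper l hl z)) (hc z)
  exact hdiff.apply_eq_apply_of_bounded (IsZLattice.isCompact_range_of_periodic L.lattice _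
    hdiff.continuous hcper).isBounded x y

theorem hasDerivAt_weierstrassP (L : PeriodPair) {z : ℂ} (hz : z ∉ L.lattice) :
    HasDerivAt L.weierstrassP (L.derivWeierstrassP z) z := by
  rw [← L.deriv_weierstrassP]
  exact (L.analyticOnNhd_weierstrassP z hz).differentiableAt.hasDerivAt

theorem tendsto_sq_mul_weierstrassP (L : PeriodPair) :
    Tendsto (fun z ↦ z ^ 2 * L.weierstrassP z) (𝓝[≠] 0) (𝓝 1) := by
  have h : Tendsto (fun z ↦ 1 + z ^ 2 * L.weierstrassPExcept 0 z) (𝓝[≠] 0) (𝓝 1) := by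
    have hc : ContinuousAt (fun z ↦ 1 + z ^ 2 * L.weierstrassPExcept 0 z) 0 := by
      have := (L.analyticAt_weierstrassPExcept 0).continuousAt
      fun_prop
    simpa using hc.tendsto.mono_left nhdsWithin_le_nhds
  refine h.congr' ?_
  filter_upwards [self_mem_nhdsWithin] with z hz
  have hz : z ≠ 0 := hz
  have e := L.weierstrassPExcept_add 0 z
  rw [← e]
  simp
  field_simp
  ring

/-- The difference `ζ(z + p) - ζ(z - p) - 2 ζ(p)`, an elliptic function of `z`. -/
def zetaDiff (L : PeriodPair) (p z : ℂ) : ℂ :=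
  L.weierstrassZeta (z + p) - L.weierstrassZeta (z - p) - 2 * L.weierstrassZeta p

theorem hasDerivAt_zetaDiff (L : PeriodPair) {p z : ℂ} (h1 : z + p ∉ L.lattice)
    (h2 : z - p ∉ L.lattice) :
    HasDerivAt (L.zetaDiff p) (L.weierstrassP (z - p) - L.weierstrassP (z + p)) z := by
  convert! (((L.hasDerivAt_weierstrassZeta h1).comp_add_const z p).sub
    ((L.hasDerivAt_weierstrassZeta h2).comp_sub_const z p)).sub_const
      (2 * L.weierstrassZeta p) using 1
  ring

theorem zetaDiff_neg (L : PeriodPair) (p z : ℂ) : L.zetaDiff p (-z) = L.zetaDiff p z := by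
  have h1 : -z + p = -(z - p) := by ring
  have h2 : -z - p = -(z + p) := by ring
  simp only [zetaDiff, h1, h2, weierstrassZeta_neg]
  ring

theorem zetaDiff_add (L : PeriodPair) {p z l : ℂ} (hl : l ∈ L.lattice) (h1 : z + p ∉ L.lattice)
    (h2 : z - p ∉ L.lattice) : L.zetaDiff p (z + l) = L.zetaDiff p z := by
  obtain ⟨η, hη⟩ := L.exists_weierstrassZeta_add hl
  have e1 := hη _ h1
  have e2 := hη _ h2
  rw [add_right_comm] at e1
  rw [sub_add_eq_add_sub] at e2
  simp only [zetaDiff, e1, e2]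
  ring

theorem notMem_of_two_mul_notMem (L : PeriodPair) {p : ℂ} (hp : 2 * p ∉ L.lattice) :
    p ∉ L.lattice := fun h ↦ hp (by simpa [two_mul] using L.lattice.add_mem h h)

theorem tendsto_mul_zetaDiff (L : PeriodPair) {p : ℂ} (hp : 2 * p ∉ L.lattice) :
    Tendsto (fun z ↦ (z - p) * L.zetaDiff p z) (𝓝[≠] p) (𝓝 (-1)) := by
  have ht : Tendsto (· - p) (𝓝[≠] p) (𝓝[≠] 0) := by
    have := ((continuous_sub_right p).tendsto p).inf
      (show Tendsto (· - p) (𝓟 {p}ᶜ) (𝓟 {0}ᶜ) by simp [sub_eq_zero])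
    simpa [nhdsWithin] using this
  have h1 := L.tendsto_mul_weierstrassZeta.comp ht
  have hc : ContinuousAt
      (fun z ↦ (z - p) * (L.weierstrassZeta (z + p) - 2 * L.weierstrassZeta p)) p := by
    have : ContinuousAt (fun z ↦ L.weierstrassZeta (z + p)) p :=
      ((L.hasDerivAt_weierstrassZeta (z := p + p) (by rwa [← two_mul])).comp_add_const
        p p).continuousAt
    fun_prop
  have h2 := hc.tendsto.mono_left (nhdsWithin_le_nhds (s := {p}ᶜ))
  convert! h2.sub h1 using 2
  · simp [zetaDiff]; ring
  · simp

theorem exists_tendsto_zetaDiff_mul_zero (L : PeriodPair) {p : ℂ} (hp : p ∉ L.lattice) :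
    ∃ c, Tendsto (fun z ↦ L.zetaDiff p z * (L.weierstrassP z - L.weierstrassP p))
      (𝓝[≠] 0) (𝓝 c) := by
  have hp' : -p ∉ L.lattice := by rwa [L.lattice.neg_mem_iff]
  set s : Set ℂ := {z | z + p ∉ L.lattice} ∩ {z | z - p ∉ L.lattice}
  have hs : s ∈ 𝓝 0 :=
    ((L.isClosed_lattice.isOpen_compl.preimage (continuous_add_const p)).inter
      (L.isClosed_lattice.isOpen_compl.preimage (continuous_sub_right p))).mem_nhds
      (by simp [hp, hp'])
  have h0 : L.zetaDiff p 0 = 0 := by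
    simp only [zetaDiff, zero_add, zero_sub, weierstrassZeta_neg]
    ring
  have hF : DifferentiableOn ℂ (L.zetaDiff p) s := fun z hz ↦
    (L.hasDerivAt_zetaDiff hz.1 hz.2).differentiableAt.differentiableWithinAt
  have hF1 := (Complex.differentiableOn_dslope hs).mpr hF
  have hF2 := (Complex.differentiableOn_dslope hs).mpr hF1
  have h1 : dslope (L.zetaDiff p) 0 0 = 0 := by
    rw [dslope_same, (L.hasDerivAt_zetaDiff (z := 0) (by simpa) (by simpa)).deriv]
    simp
  have hFeq : ∀ z, L.zetaDiff p z = z ^ 2 * dslope (dslope (L.zetaDiff p) 0) 0 z := by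
    intro z
    have e1 := sub_smul_dslope (L.zetaDiff p) 0 z
    have e2 := sub_smul_dslope (dslope (L.zetaDiff p) 0) 0 z
    simp only [h0, h1, sub_zero, smul_eq_mul] at e1 e2
    rw [← e1, ← e2]
    ring
  have hcont : ContinuousAt (dslope (dslope (L.zetaDiff p) 0) 0) 0 :=
    (hF2.differentiableAt hs).continuousAt
  have hlim := hcont.tendsto.mono_left (nhdsWithin_le_nhds (s := {0}ᶜ))
  have hsq : Tendsto (fun z : ℂ ↦ z ^ 2 * L.weierstrassP p) (𝓝[≠] 0)
      (𝓝 (0 ^ 2 * L.weierstrassP p)) :=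
    (Continuous.tendsto (by fun_prop) 0).mono_left nhdsWithin_le_nhds
  refine ⟨_, (hlim.mul (L.tendsto_sq_mul_weierstrassP.sub hsq)).congr fun z ↦ ?_⟩
  rw [hFeq]
  ring

/-- The addition theorem `ζ(z + p) - ζ(z - p) - 2 ζ(p) = -℘'(p) / (℘(z) - ℘(p))`. -/
theorem zetaDiff_mul (L : PeriodPair) {p z : ℂ} (hp : 2 * p ∉ L.lattice) (hz : z ∉ L.lattice)
    (h1 : z + p ∉ L.lattice) (h2 : z - p ∉ L.lattice) :
    L.zetaDiff p z * (L.weierstrassP z - L.weierstrassP p) = -L.derivWeierstrassP p := by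
  have hpL := L.notMem_of_two_mul_notMem hp
  set H : ℂ → ℂ := fun z ↦ L.zetaDiff p z * (L.weierstrassP z - L.weierstrassP p) with hH
  have hdiff : ∀ z, z ∉ L.lattice → z + p ∉ L.lattice → z - p ∉ L.lattice →
      DifferentiableAt ℂ H z := fun z hz h1 h2 ↦
    (L.hasDerivAt_zetaDiff h1 h2).differentiableAt.mul
      ((L.hasDerivAt_weierstrassP hz).differentiableAt.sub_const _)
  have hev : ∀ x, ∀ᶠ z in 𝓝[≠] x, z ∉ L.lattice ∧ z + p ∉ L.lattice ∧ z - p ∉ L.lattice := by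
    intro x
    filter_upwards [L.compl_lattice_mem_nhdsNE 0 x, L.compl_lattice_mem_nhdsNE p x,
      L.compl_lattice_mem_nhdsNE (-p) x] with z h0 h1 h2
    exact ⟨by simpa using h0, h1, by simpa [sub_eq_add_neg] using h2⟩
  have hper : ∀ l ∈ L.lattice, ∀ x, ∀ᶠ z in 𝓝[≠] x, H (z + l) = H z := by
    intro l hl x
    filter_upwards [hev x] with z hz
    simp only [hH, L.zetaDiff_add hl hz.2.1 hz.2.2, L.weierstrassP_add_coe z ⟨l, hl⟩]
  have hlimp : Tendsto H (𝓝[≠] p) (𝓝 (-L.derivWeierstrassP p)) := by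
    have hslope := hasDerivAt_iff_tendsto_slope.mp (L.hasDerivAt_weierstrassP hpL)
    have := (L.tendsto_mul_zetaDiff hp).mul hslope
    rw [neg_one_mul] at this
    refine this.congr' ?_
    filter_upwards [self_mem_nhdsWithin] with z hz
    have : z - p ≠ 0 := sub_ne_zero.mpr hz
    simp only [hH, slope_def_field]
    field_simp
  have hlimnp : Tendsto H (𝓝[≠] (-p)) (𝓝 (-L.derivWeierstrassP p)) := by
    have ht : Tendsto (fun z : ℂ ↦ -z) (𝓝[≠] (-p)) (𝓝[≠] p) := by
      have := ((continuous_neg (G := ℂ)).tendsto (-p)).inf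
        (show Tendsto (fun z : ℂ ↦ -z) (𝓟 {-p}ᶜ) (𝓟 {p}ᶜ) by simp [neg_eq_iff_eq_neg])
      simpa [nhdsWithin] using this
    refine (hlimp.comp ht).congr fun z ↦ ?_
    simp [hH, L.zetaDiff_neg]
  have hlim : ∀ x, ∃ c, Tendsto H (𝓝[≠] x) (𝓝 c) := by
    have hshift : ∀ x y, x - y ∈ L.lattice → (∃ c, Tendsto H (𝓝[≠] y) (𝓝 c)) →
        ∃ c, Tendsto H (𝓝[≠] x) (𝓝 c) := by
      rintro x y hl ⟨c, hc⟩
      have ht : Tendsto (· + (y - x)) (𝓝[≠] x) (𝓝[≠] y) := by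
        have := ((continuous_add_const (y - x)).tendsto x).inf
          (show Tendsto (· + (y - x)) (𝓟 {x}ᶜ) (𝓟 {y}ᶜ) from tendsto_principal_principal.mpr
            fun w hw h ↦ hw (by
              simp only [Set.mem_singleton_iff] at h ⊢
              linear_combination h))
        simpa [nhdsWithin] using this
      have hl' : y - x ∈ L.lattice := by simpa using L.lattice.neg_mem hl
      exact ⟨c, (hc.comp ht).congr' (hper _ hl' x)⟩
    intro x
    by_cases hx0 : x ∈ L.lattice
    · exact hshift x 0 (by simpa) (L.exists_tendsto_zetaDiff_mul_zero hpL)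
    by_cases hx1 : x + p ∈ L.lattice
    · exact hshift x (-p) (by simpa) ⟨_, hlimnp⟩
    by_cases hx2 : x - p ∈ L.lattice
    · exact hshift x p hx2 ⟨_, hlimp⟩
    exact ⟨_, (hdiff x hx0 hx1 hx2).continuousAt.tendsto.mono_left nhdsWithin_le_nhds⟩
  choose c hc using hlim
  have hconst := L.exists_tendsto_of_periodic
    (fun x ↦ (hev x).mono fun z hz ↦ hdiff z hz.1 hz.2.1 hz.2.2) hper hc z p
  have e1 : c p = -L.derivWeierstrassP p := tendsto_nhds_unique (hc p) hlimp
  have e2 : c z = H z := tendsto_nhds_unique (hc z)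
    ((hdiff z hz h1 h2).continuousAt.tendsto.mono_left nhdsWithin_le_nhds)
  exact e2.symm.trans (hconst.trans e1)

theorem derivWeierstrassP_ne_zero (L : PeriodPair) {p : ℂ} (hp : 2 * p ∉ L.lattice) :
    L.derivWeierstrassP p ≠ 0 := by
  intro h0
  have hpL := L.notMem_of_two_mul_notMem hp
  have hev : ∀ᶠ z in 𝓝[≠] p, L.weierstrassP z = L.weierstrassP p := by
    filter_upwards [L.compl_lattice_mem_nhdsNE 0 p, L.compl_lattice_mem_nhdsNE p p,
      L.compl_lattice_mem_nhdsNE (-p) p,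
      (L.tendsto_mul_zetaDiff hp).eventually_ne (neg_ne_zero.mpr one_ne_zero)] with z h1 h2 h3 h4
    have := L.zetaDiff_mul hp (by simpa using h1) h2 (by simpa [sub_eq_add_neg] using h3)
    rw [h0, neg_zero, mul_eq_zero] at this
    exact sub_eq_zero.mp (this.resolve_left (right_ne_zero_of_mul h4))
  have hev' : L.weierstrassP =ᶠ[𝓝 p] fun _ ↦ L.weierstrassP p := by
    have := eventually_nhdsWithin_iff.mp hev
    filter_upwards [this] with z hz
    by_cases h : z = p
    · rw [h]
    · exact hz h
  have heq := L.analyticOnNhd_weierstrassP.eqOn_of_preconnected_of_eventuallyEq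
    (analyticOnNhd_const) L.isPreconnected_compl_lattice hpL hev'
  have hlim : Tendsto (fun z ↦ z ^ 2 * L.weierstrassP z) (𝓝[≠] 0)
      (𝓝 (0 ^ 2 * L.weierstrassP p)) := by
    refine Tendsto.congr' (f₁ := fun z : ℂ ↦ z ^ 2 * L.weierstrassP p) ?_
      ((Continuous.tendsto (by fun_prop) 0).mono_left nhdsWithin_le_nhds)
    filter_upwards [L.compl_lattice_mem_nhdsNE 0 0] with z hz
    rw [heq (x := z) (by simpa using hz)]
  simpa using tendsto_nhds_unique hlim L.tendsto_sq_mul_weierstrassP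

theorem eventually_mul_add_notMem (L : PeriodPair) {a b z : ℂ} (h : a * z + b ∉ L.lattice) :
    ∀ᶠ w in 𝓝 z, a * w + b ∉ L.lattice := by
  have ht : Tendsto (fun w ↦ a * w + b) (𝓝 z) (𝓝 (a * z + b)) :=
    Continuous.tendsto (by fun_prop) z
  exact ht.eventually (L.isClosed_lattice.isOpen_compl.mem_nhds h)

theorem eventually_two_mul_notMem (L : PeriodPair) (p : ℂ) :
    ∀ᶠ z in 𝓝[≠] p, 2 * z ∉ L.lattice := by
  have ht : Tendsto (2 * ·) (𝓝[≠] p) (𝓝[≠] (2 * p)) := by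
    have := ((continuous_const_mul (2 : ℂ)).tendsto p).inf
      (show Tendsto (2 * ·) (𝓟 {p}ᶜ) (𝓟 {2 * p}ᶜ) by simp)
    simpa [nhdsWithin] using this
  filter_upwards [ht.eventually (L.compl_lattice_mem_nhdsNE 0 (2 * p))] with z hz
  simpa using hz

/-- The second order differential equation `℘'' = 6 ℘² - g₂ / 2`. -/
theorem hasDerivAt_derivWeierstrassP (L : PeriodPair) {z : ℂ} (hz : z ∉ L.lattice) :
    HasDerivAt L.derivWeierstrassP (6 * L.weierstrassP z ^ 2 - L.g₂ / 2) z := by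
  have han := L.analyticOnNhd_derivWeierstrassP
  have hodd : ∀ w, w ∉ L.lattice → 2 * w ∉ L.lattice →
      deriv L.derivWeierstrassP w = 6 * L.weierstrassP w ^ 2 - L.g₂ / 2 := by
    intro w hw h2w
    have hP := L.hasDerivAt_weierstrassP hw
    have h1 := (han w hw).differentiableAt.hasDerivAt.pow 2
    have h2 := (((hP.pow 3).const_mul 4).sub (hP.const_mul L.g₂)).sub_const L.g₃
    have heq : L.derivWeierstrassP ^ 2 =ᶠ[𝓝 w]
        fun w ↦ 4 * L.weierstrassP w ^ 3 - L.g₂ * L.weierstrassP w - L.g₃ := by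
      filter_upwards [L.isClosed_lattice.isOpen_compl.mem_nhds hw] with v hv
      exact L.derivWeierstrassP_sq v hv
    have h3 := h1.unique (h2.congr_of_eventuallyEq heq)
    refine mul_left_cancel₀ (mul_ne_zero two_ne_zero (L.derivWeierstrassP_ne_zero h2w)) ?_
    linear_combination h3
  have h1 : Tendsto (deriv L.derivWeierstrassP) (𝓝[≠] z) (𝓝 (deriv L.derivWeierstrassP z)) :=
    (han z hz).deriv.continuousAt.tendsto.mono_left nhdsWithin_le_nhds
  have h2 : Tendsto (fun w ↦ 6 * L.weierstrassP w ^ 2 - L.g₂ / 2) (𝓝[≠] z)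
      (𝓝 (6 * L.weierstrassP z ^ 2 - L.g₂ / 2)) := by
    have hc : ContinuousAt (fun w ↦ 6 * L.weierstrassP w ^ 2 - L.g₂ / 2) z := by
      have := (L.hasDerivAt_weierstrassP hz).continuousAt
      fun_prop
    exact hc.tendsto.mono_left nhdsWithin_le_nhds
  have heq : deriv L.derivWeierstrassP z = 6 * L.weierstrassP z ^ 2 - L.g₂ / 2 := by
    refine tendsto_nhds_unique (h1.congr' ?_) h2
    filter_upwards [L.eventually_two_mul_notMem z, L.compl_lattice_mem_nhdsNE 0 z] with w hw hw0
    exact hodd w (by simpa using hw0) hw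
  exact heq ▸ (han z hz).differentiableAt.hasDerivAt

theorem weierstrassP_sub_ne_zero (L : PeriodPair) {p z : ℂ} (hp : 2 * p ∉ L.lattice)
    (hz : z ∉ L.lattice) (h1 : z + p ∉ L.lattice) (h2 : z - p ∉ L.lattice) :
    L.weierstrassP z - L.weierstrassP p ≠ 0 := by
  refine right_ne_zero_of_mul (a := L.zetaDiff p z) ?_
  rw [L.zetaDiff_mul hp hz h1 h2]
  exact neg_ne_zero.mpr (L.derivWeierstrassP_ne_zero hp)

theorem weierstrassP_add_add_weierstrassP_sub (L : PeriodPair) {p z : ℂ}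
    (hp : 2 * p ∉ L.lattice) (hz : z ∉ L.lattice) (h1 : z + p ∉ L.lattice)
    (h2 : z - p ∉ L.lattice) :
    (2 * L.weierstrassP p - L.weierstrassP (z + p) - L.weierstrassP (z - p)) *
        (L.weierstrassP z - L.weierstrassP p) - L.zetaDiff p z * L.derivWeierstrassP p =
      -(6 * L.weierstrassP p ^ 2 - L.g₂ / 2) := by
  have hpL := L.notMem_of_two_mul_notMem hp
  have heq : (fun q ↦ L.zetaDiff q z * (L.weierstrassP z - L.weierstrassP q)) =ᶠ[𝓝 p]
      fun q ↦ -L.derivWeierstrassP q := by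
    filter_upwards [L.eventually_mul_add_notMem (a := 2) (b := 0) (by simpa using hp),
      L.eventually_mul_add_notMem (a := 1) (b := z) (z := p) (by simpa [add_comm] using h1),
      L.eventually_mul_add_notMem (a := -1) (b := z) (z := p) (by simpa [neg_add_eq_sub] using h2)]
      with q hq hq1 hq2
    exact L.zetaDiff_mul (by simpa using hq) hz (by simpa [add_comm] using hq1)
      (by simpa [neg_add_eq_sub] using hq2)
  have hd1 : HasDerivAt (fun q ↦ L.zetaDiff q z) _ p :=
    (((L.hasDerivAt_weierstrassZeta h1).comp_const_add z p).sub
      ((L.hasDerivAt_weierstrassZeta h2).comp_const_sub z p)).sub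
      ((L.hasDerivAt_weierstrassZeta hpL).const_mul 2)
  have hd := hd1.mul ((L.hasDerivAt_weierstrassP hpL).const_sub (L.weierstrassP z))
  have := hd.unique ((L.hasDerivAt_derivWeierstrassP hpL).neg.congr_of_eventuallyEq heq)
  linear_combination this

/-- The duplication formula for the Weierstrass `ζ`-function. -/
theorem weierstrassZeta_two_mul (L : PeriodPair) {p : ℂ} (hp : 2 * p ∉ L.lattice) :
    2 * L.derivWeierstrassP p * (L.weierstrassZeta (2 * p) - 2 * L.weierstrassZeta p) =
      6 * L.weierstrassP p ^ 2 - L.g₂ / 2 := by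
  have hpL := L.notMem_of_two_mul_notMem hp
  have hs1 := hasDerivAt_iff_tendsto_slope.mp (L.hasDerivAt_weierstrassP hpL)
  have hs2 := hasDerivAt_iff_tendsto_slope.mp (L.hasDerivAt_derivWeierstrassP hpL)
  have hc : ContinuousAt (fun z ↦ L.weierstrassZeta (z + p) - L.weierstrassZeta p -
      L.weierstrassZeta z) p := by
    have h1 : ContinuousAt (fun z ↦ L.weierstrassZeta (z + p)) p :=
      ((L.hasDerivAt_weierstrassZeta (z := p + p) (by rwa [← two_mul])).comp_add_const
        p p).continuousAt
    have h2 := (L.hasDerivAt_weierstrassZeta hpL).continuousAt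
    fun_prop
  have hlim := ((hc.tendsto.mono_left (nhdsWithin_le_nhds (s := {p}ᶜ))).const_mul 2).mul hs1
  have := tendsto_nhds_unique (hlim.congr' ?_) hs2
  · rw [two_mul p]
    linear_combination this
  filter_upwards [self_mem_nhdsWithin, L.eventually_two_mul_notMem p,
    L.compl_lattice_mem_nhdsNE 0 p, L.compl_lattice_mem_nhdsNE p p,
    L.compl_lattice_mem_nhdsNE (-p) p] with z hne h2z hz h1 h2
  rw [add_zero] at hz
  rw [← sub_eq_add_neg] at h2
  have hzp : z - p ≠ 0 := sub_ne_zero.mpr hne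
  have e1 := L.zetaDiff_mul hp hz h1 h2
  have e2 := L.zetaDiff_mul h2z hpL (by rwa [add_comm])
    (by rwa [← L.lattice.neg_mem_iff, neg_sub])
  have e3 := L.weierstrassZeta_neg (z - p)
  rw [neg_sub] at e3
  simp only [zetaDiff, e3, add_comm p z] at e1 e2
  rw [slope_def_field, slope_def_field, mul_div_assoc', div_left_inj' hzp]
  linear_combination e1 - e2

/-- The duplication formula for the Weierstrass `℘`-function. -/
theorem weierstrassP_two_mul (L : PeriodPair) {p : ℂ} (hp : 2 * p ∉ L.lattice) :
    4 * L.derivWeierstrassP p ^ 2 * (L.weierstrassP (2 * p) + 2 * L.weierstrassP p) =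
      (6 * L.weierstrassP p ^ 2 - L.g₂ / 2) ^ 2 := by
  have hpL := L.notMem_of_two_mul_notMem hp
  have heq : (fun q ↦ 2 * L.derivWeierstrassP q *
        (L.weierstrassZeta (2 * q) - 2 * L.weierstrassZeta q)) =ᶠ[𝓝 p]
      fun q ↦ 6 * L.weierstrassP q ^ 2 - L.g₂ / 2 := by
    filter_upwards [L.eventually_mul_add_notMem (a := 2) (b := 0) (by simpa using hp)] with q hq
    exact L.weierstrassZeta_two_mul (by simpa using hq)
  have hd1 : HasDerivAt (fun q ↦ L.weierstrassZeta (2 * q)) (2 * -L.weierstrassP (2 * p)) p := by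
    convert! (L.hasDerivAt_weierstrassZeta hp).comp p ((hasDerivAt_id p).const_mul 2) using 1
    ring
  have hd := ((L.hasDerivAt_derivWeierstrassP hpL).const_mul 2).mul
    (hd1.sub ((L.hasDerivAt_weierstrassZeta hpL).const_mul 2))
  have hd2 := (((L.hasDerivAt_weierstrassP hpL).pow 2).const_mul 6).sub_const (L.g₂ / 2)
  have := hd.unique (hd2.congr_of_eventuallyEq heq)
  simp only [Pi.sub_apply] at this
  have e := L.weierstrassZeta_two_mul hp
  linear_combination -L.derivWeierstrassP p * this + (6 * L.weierstrassP p ^ 2 - L.g₂ / 2) * e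

theorem summable_norm_lattice (L : PeriodPair) :
    Summable fun l : L.lattice ↦ ‖(l : ℂ)‖ ^ (-3 : ℝ) :=
  ZLattice.summable_norm_rpow _ _ (by simp; norm_num)

end PeriodPair

/-- The periods `1, τ` with `τ` in the upper half plane. -/
def oneTauPair (τ : ℂ) (hτ : 0 < τ.im) : PeriodPair where
  ω₁ := 1
  ω₂ := τ
  indep := by
    refine LinearIndependent.pair_iff.mpr fun s t h ↦ ?_
    have ht : t = 0 := by simpa [hτ.ne'] using congrArg Complex.im h
    exact ⟨by simpa [ht] using h, ht⟩

theorem mem_oneTauPair_lattice {τ : ℂ} (hτ : 0 < τ.im) {x : ℂ} :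
    x ∈ (oneTauPair τ hτ).lattice ↔ x ∈ Lam τ := by
  simp [PeriodPair.mem_lattice, oneTauPair, Lam, eq_comm]

/-- The inclusion of the nonzero lattice points into the lattice. -/
def Lam'.toLattice {τ : ℂ} (hτ : 0 < τ.im) (ω : Lam' τ) : (oneTauPair τ hτ).lattice :=
  ⟨ω, (mem_oneTauPair_lattice hτ).mpr ω.2.1⟩

theorem Lam'.coe_toLattice {τ : ℂ} (hτ : 0 < τ.im) (ω : Lam' τ) :
    (Lam'.toLattice hτ ω : ℂ) = ω := rfl

theorem Lam'.toLattice_injective {τ : ℂ} (hτ : 0 < τ.im) :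
    Function.Injective (Lam'.toLattice hτ) :=
  fun _ _ h ↦ Subtype.ext (congrArg (fun l : (oneTauPair τ hτ).lattice ↦ (l : ℂ)) h)

theorem hasSum_Lam' {τ : ℂ} (hτ : 0 < τ.im) {f : ℂ → ℂ} {a : ℂ}
    (h : HasSum (fun l : (oneTauPair τ hτ).lattice ↦ if l.1 = 0 then 0 else f l) a) :
    HasSum (fun ω : Lam' τ ↦ f ω) a := by
  have := ((Lam'.toLattice_injective hτ).hasSum_iff fun l hl ↦ if_pos (by_contra fun h0 ↦
    hl ⟨⟨l, (mem_oneTauPair_lattice hτ).mp l.2, h0⟩, rfl⟩)).mpr h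
  convert! this using 2 with ω
  exact (if_neg ω.2.2).symm

theorem hasSum_wzeta {τ : ℂ} (hτ : 0 < τ.im) (z : ℂ) :
    HasSum (fun ω : Lam' τ ↦ 1 / (z - (ω : ℂ)) + 1 / (ω : ℂ) + z / (ω : ℂ) ^ 2)
      ((oneTauPair τ hτ).weierstrassZetaReg z) :=
  hasSum_Lam' hτ (f := fun l ↦ 1 / (z - l) + 1 / l + z / l ^ 2)
    (oneTauPair τ hτ).hasSumLocallyUniformly_weierstrassZetaReg.hasSum

theorem wzeta_eq_weierstrassZeta {τ : ℂ} (hτ : 0 < τ.im) :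
    wzeta τ = (oneTauPair τ hτ).weierstrassZeta := by
  ext z
  rw [wzeta, PeriodPair.weierstrassZeta, (hasSum_wzeta hτ z).tsum_eq]

theorem wp_eq_weierstrassP {τ : ℂ} (hτ : 0 < τ.im) :
    wp τ = (oneTauPair τ hτ).weierstrassP := by
  ext z
  have h := (oneTauPair τ hτ).hasSum_weierstrassPExcept 0 z
  have h0 := (oneTauPair τ hτ).weierstrassPExcept_add 0 z
  rw [wp, (hasSum_Lam' hτ (f := fun l ↦ 1 / (z - l) ^ 2 - 1 / l ^ 2) h).tsum_eq]
  simpa [add_comm] using h0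

theorem wpd_eq_derivWeierstrassP {τ : ℂ} (hτ : 0 < τ.im) :
    wpd τ = (oneTauPair τ hτ).derivWeierstrassP := by
  rw [wpd, wp_eq_weierstrassP hτ, PeriodPair.deriv_weierstrassP]

theorem wpdd_eq {τ : ℂ} (hτ : 0 < τ.im) {z : ℂ} (hz : z ∉ (oneTauPair τ hτ).lattice) :
    wpdd τ z = 6 * (oneTauPair τ hτ).weierstrassP z ^ 2 - (oneTauPair τ hτ).g₂ / 2 := by
  rw [wpdd, wp_eq_weierstrassP hτ, PeriodPair.deriv_weierstrassP]
  exact ((oneTauPair τ hτ).hasDerivAt_derivWeierstrassP hz).deriv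

/-- The Weierstrass elementary factor of genus two. -/
def elemFactor (u : ℂ) : ℂ := (1 - u) * exp (u + u ^ 2 / 2)

theorem hasDerivAt_elemFactor (u : ℂ) :
    HasDerivAt elemFactor (-u ^ 2 * exp (u + u ^ 2 / 2)) u := by
  have h1 : HasDerivAt (fun u : ℂ ↦ u + u ^ 2 / 2) (1 + u) u := by
    convert! (hasDerivAt_id u).add (((hasDerivAt_id u).pow 2).div_const 2) using 1
    simp
  convert! ((hasDerivAt_id u).const_sub 1).mul h1.cexp using 1
  simp only [id]; ring

theorem norm_elemFactor_sub_one_le {u : ℂ} (hu : ‖u‖ ≤ 1) :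
    ‖elemFactor u - 1‖ ≤ Real.exp 2 * ‖u‖ ^ 3 := by
  have hb : ∀ v ∈ Metric.closedBall (0 : ℂ) ‖u‖,
      ‖-v ^ 2 * exp (v + v ^ 2 / 2)‖ ≤ ‖u‖ ^ 2 * Real.exp 2 := by
    intro v hv
    rw [mem_closedBall_zero_iff] at hv
    have hv1 := hv.trans hu
    rw [norm_mul, norm_neg, norm_pow, norm_exp]
    gcongr
    refine (re_le_norm _).trans ((norm_add_le _ _).trans ?_)
    rw [norm_div, norm_pow, RCLike.norm_ofNat]
    nlinarith [norm_nonneg v]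
  have := (convex_closedBall (0 : ℂ) ‖u‖).norm_image_sub_le_of_norm_hasDerivWithin_le
    (fun v _ ↦ (hasDerivAt_elemFactor v).hasDerivWithinAt) hb (x := 0) (y := u)
    (by simp) (by simp)
  simp only [elemFactor, sub_zero] at this ⊢
  norm_num at this
  exact this.trans_eq (by ring)

theorem wsigma_eq (τ z : ℂ) :
    wsigma τ z = z * ∏' ω : Lam' τ, (1 + (elemFactor (z / ω) - 1)) := by
  rw [wsigma]
  congr! 3 with ω
  rw [elemFactor, add_sub_cancel]
  congr 3
  ring

theorem logDeriv_elemFactor {z ω : ℂ} (hω : ω ≠ 0) (hz : z ≠ ω) :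
    logDeriv (fun z ↦ 1 + (elemFactor (z / ω) - 1)) z = 1 / (z - ω) + 1 / ω + z / ω ^ 2 := by
  have h1 : ω - z ≠ 0 := sub_ne_zero.mpr hz.symm
  have h2 : z - ω ≠ 0 := sub_ne_zero.mpr hz
  have hc : HasDerivAt (fun z ↦ elemFactor (z / ω)) _ z :=
    (hasDerivAt_elemFactor (z / ω)).comp (h := fun z ↦ z / ω) z ((hasDerivAt_id' z).div_const ω)
  have hd := (hc.sub_const 1).const_add 1
  rw [logDeriv_apply, hd.deriv, add_sub_cancel, elemFactor]
  have he := exp_ne_zero (z / ω + (z / ω) ^ 2 / 2)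
  generalize exp (z / ω + (z / ω) ^ 2 / 2) = e at he
  have h3 : 1 - z / ω = (ω - z) / ω := by field_simp
  rw [h3]
  field_simp
  ring

theorem summable_norm_Lam' {τ : ℂ} (hτ : 0 < τ.im) :
    Summable (fun ω : Lam' τ ↦ ‖(ω : ℂ)‖ ^ (-3 : ℝ)) := by
  have h := (oneTauPair τ hτ).summable_norm_lattice.comp_injective (Lam'.toLattice_injective hτ)
  simpa only [Function.comp_def, Lam'.coe_toLattice] using h

theorem eventually_norm_elemFactor_le {τ : ℂ} (hτ : 0 < τ.im) {R : ℝ} (hR : 0 < R) :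
    ∀ᶠ ω : Lam' τ in cofinite, ∀ z ∈ Metric.ball (0 : ℂ) R,
      ‖elemFactor (z / ω) - 1‖ ≤ Real.exp 2 * R ^ 3 * ‖(ω : ℂ)‖ ^ (-3 : ℝ) := by
  filter_upwards [(summable_norm_Lam' hτ).tendsto_cofinite_zero.eventually_lt_const
    (Real.rpow_pos_of_pos hR (-3))] with ω hω z hz
  rw [mem_ball_zero_iff] at hz
  have h0 : 0 < ‖(ω : ℂ)‖ := norm_pos_iff.mpr ω.2.2
  have hRω : R < ‖(ω : ℂ)‖ := (Real.rpow_lt_rpow_iff_of_neg h0 hR (by norm_num)).mp hω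
  have h1 : ‖z / ω‖ ≤ R / ‖(ω : ℂ)‖ := by rw [norm_div]; gcongr
  refine (norm_elemFactor_sub_one_le (h1.trans ?_)).trans ?_
  · exact (div_le_one h0).mpr hRω.le
  · calc Real.exp 2 * ‖z / ω‖ ^ 3 ≤ Real.exp 2 * (R / ‖(ω : ℂ)‖) ^ 3 := by gcongr
      _ = Real.exp 2 * R ^ 3 * (‖(ω : ℂ)‖ ^ 3)⁻¹ := by ring
      _ = _ := by rw [Real.rpow_neg h0.le]; norm_cast

theorem elemFactor_ne_zero {u : ℂ} (hu : u ≠ 1) : elemFactor u ≠ 0 :=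
  mul_ne_zero (sub_ne_zero.mpr hu.symm) (exp_ne_zero _)

theorem wsigma_ne_zero {τ : ℂ} (hτ : 0 < τ.im) {z : ℂ} (hz : z ∉ (oneTauPair τ hτ).lattice) :
    wsigma τ z ≠ 0 := by
  rw [wsigma_eq]
  refine mul_ne_zero (by rintro rfl; exact hz (zero_mem _))
    (tprod_one_add_ne_zero_of_summable (fun ω ↦ ?_) ?_)
  · rw [add_sub_cancel]
    refine elemFactor_ne_zero fun h ↦ hz ?_
    rw [(div_eq_one_iff_eq ω.2.2).mp h]
    exact (Lam'.toLattice hτ ω).2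
  · refine .of_norm_bounded_eventually
      (g := fun ω : Lam' τ ↦ Real.exp 2 * (‖z‖ + 1) ^ 3 * ‖(ω : ℂ)‖ ^ (-3 : ℝ))
      ((summable_norm_Lam' hτ).mul_left _) ?_
    filter_upwards [eventually_norm_elemFactor_le hτ (R := ‖z‖ + 1) (by positivity)] with ω hω
    simpa using hω z (by simp)

theorem hasDerivAt_wsigma {τ : ℂ} (hτ : 0 < τ.im) {z : ℂ}
    (hz : z ∉ (oneTauPair τ hτ).lattice) :
    HasDerivAt (wsigma τ) (wsigma τ z * (oneTauPair τ hτ).weierstrassZeta z) z := by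
  have hz0 : z ≠ 0 := by rintro rfl; exact hz (zero_mem _)
  have hzω : ∀ ω : Lam' τ, z ≠ ω := by
    rintro ω rfl
    exact hz (Lam'.toLattice hτ ω).2
  have hdf : ∀ ω : Lam' τ, Differentiable ℂ fun z ↦ 1 + (elemFactor (z / ω) - 1) := fun ω ↦ by
    have : Differentiable ℂ elemFactor := fun u ↦ (hasDerivAt_elemFactor u).differentiableAt
    fun_prop
  have hm := Summable.multipliableLocallyUniformlyOn_one_add Metric.isOpen_ball
    ((summable_norm_Lam' hτ).mul_left _)
    (eventually_norm_elemFactor_le hτ (R := ‖z‖ + 1) (by positivity))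
    (fun ω ↦ ((hdf ω).continuous.sub continuous_const).continuousOn.congr
      fun _ _ ↦ (add_sub_cancel_left _ _).symm)
  have hzR : z ∈ Metric.ball (0 : ℂ) (‖z‖ + 1) := by simp
  have hσ : wsigma τ = fun z ↦ z * ∏' ω : Lam' τ, (1 + (elemFactor (z / ω) - 1)) :=
    funext (wsigma_eq τ)
  have hne := wsigma_ne_zero hτ hz
  rw [wsigma_eq] at hne
  have hP := right_ne_zero_of_mul hne
  have hlog : ∀ ω : Lam' τ, logDeriv (fun z ↦ 1 + (elemFactor (z / ω) - 1)) z =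
      1 / (z - ω) + 1 / ω + z / (ω : ℂ) ^ 2 := fun ω ↦ logDeriv_elemFactor ω.2.2 (hzω ω)
  have hL := logDeriv_tprod_eq_tsum Metric.isOpen_ball hzR
    (f := fun (ω : Lam' τ) z ↦ 1 + (elemFactor (z / ω) - 1))
    (fun ω ↦ by
      rw [add_sub_cancel]
      exact elemFactor_ne_zero fun h ↦ hzω ω ((div_eq_one_iff_eq ω.2.2).mp h))
    (fun ω ↦ (hdf ω).differentiableOn)
    ((hasSum_wzeta hτ z).summable.congr fun ω ↦ (hlog ω).symm) hm hP
  simp_rw [hlog] at hL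
  rw [(hasSum_wzeta hτ z).tsum_eq, logDeriv_apply, div_eq_iff hP] at hL
  have hd : DifferentiableAt ℂ (fun z ↦ ∏' ω : Lam' τ, (1 + (elemFactor (z / ω) - 1))) z :=
    (hm.hasProdLocallyUniformlyOn.differentiableOn
      (.of_forall fun _ ↦ .fun_finsetProd fun ω _ ↦ (hdf ω).differentiableOn)
      Metric.isOpen_ball).differentiableAt (Metric.isOpen_ball.mem_nhds hzR)
  have := (hasDerivAt_id z).mul (hL ▸ hd.hasDerivAt)
  rw [wsigma_eq]
  rw [hσ]
  convert! this using 1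
  simp only [PeriodPair.weierstrassZeta, id]
  field

theorem hasDerivAt_fdev {τ p z : ℂ} (hτ : 0 < τ.im) (h1 : z + p ∉ (oneTauPair τ hτ).lattice)
    (h2 : z - p ∉ (oneTauPair τ hτ).lattice) :
    HasDerivAt (fdev τ p) (fdev τ p z * (-2 * (oneTauPair τ hτ).zetaDiff p z)) z := by
  have hn := wsigma_ne_zero hτ h1
  have hd1 := ((hasDerivAt_wsigma hτ h1).comp_add_const z p).pow 2
  have hd2 := ((hasDerivAt_wsigma hτ h2).comp_sub_const z p).pow 2
  have he := ((hasDerivAt_id' z).const_mul (4 * wzeta τ p)).cexp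
  convert! (he.mul hd2).div hd1 (pow_ne_zero 2 hn) using 1
  simp only [fdev, PeriodPair.zetaDiff, wzeta_eq_weierstrassZeta hτ, Pi.mul_apply, Pi.pow_apply]
  field_simp
  ring

theorem fdev_ne_zero {τ p z : ℂ} (hτ : 0 < τ.im) (h1 : z + p ∉ (oneTauPair τ hτ).lattice)
    (h2 : z - p ∉ (oneTauPair τ hτ).lattice) : fdev τ p z ≠ 0 :=
  div_ne_zero (mul_ne_zero (exp_ne_zero _) (pow_ne_zero 2 (wsigma_ne_zero hτ h2)))
    (pow_ne_zero 2 (wsigma_ne_zero hτ h1))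

theorem deriv_fdev {τ p z : ℂ} (hτ : 0 < τ.im) (hp : 2 * p ∉ (oneTauPair τ hτ).lattice)
    (hz : z ∉ (oneTauPair τ hτ).lattice) (h1 : z + p ∉ (oneTauPair τ hτ).lattice)
    (h2 : z - p ∉ (oneTauPair τ hτ).lattice) :
    deriv (fdev τ p) z = fdev τ p z * (2 * (oneTauPair τ hτ).derivWeierstrassP p /
      ((oneTauPair τ hτ).weierstrassP z - (oneTauPair τ hτ).weierstrassP p)) := by
  have hD := (oneTauPair τ hτ).weierstrassP_sub_ne_zero hp hz h1 h2
  rw [(hasDerivAt_fdev hτ h1 h2).deriv]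
  congr 1
  rw [eq_div_iff hD]
  linear_combination -2 * (oneTauPair τ hτ).zetaDiff_mul hp hz h1 h2

theorem eventually_notMem_lattice (L : PeriodPair) {p z : ℂ} (hz : z ∉ L.lattice)
    (h1 : z + p ∉ L.lattice) (h2 : z - p ∉ L.lattice) :
    ∀ᶠ w in 𝓝 z, w ∉ L.lattice ∧ w + p ∉ L.lattice ∧ w - p ∉ L.lattice := by
  filter_upwards [L.eventually_mul_add_notMem (a := 1) (b := 0) (z := z) (by simpa using hz),
    L.eventually_mul_add_notMem (a := 1) (b := p) (z := z) (by simpa using h1),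
    L.eventually_mul_add_notMem (a := 1) (b := -p) (z := z) (by simpa [← sub_eq_add_neg] using h2)]
    with w hw hw1 hw2
  exact ⟨by simpa using hw, by simpa using hw1, by simpa [← sub_eq_add_neg] using hw2⟩

theorem deriv_deriv_fdev_div {τ p z : ℂ} (hτ : 0 < τ.im)
    (hp : 2 * p ∉ (oneTauPair τ hτ).lattice)
    (hz : z ∉ (oneTauPair τ hτ).lattice) (h1 : z + p ∉ (oneTauPair τ hτ).lattice)
    (h2 : z - p ∉ (oneTauPair τ hτ).lattice) :
    deriv (deriv (fdev τ p)) z / deriv (fdev τ p) z =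
      (2 * (oneTauPair τ hτ).derivWeierstrassP p - (oneTauPair τ hτ).derivWeierstrassP z) /
        ((oneTauPair τ hτ).weierstrassP z - (oneTauPair τ hτ).weierstrassP p) := by
  have hD := (oneTauPair τ hτ).weierstrassP_sub_ne_zero hp hz h1 h2
  have hf := fdev_ne_zero hτ h1 h2
  have hy := (oneTauPair τ hτ).derivWeierstrassP_ne_zero hp
  have hd0 : HasDerivAt (fdev τ p) _ z := (hasDerivAt_fdev hτ h1 h2).differentiableAt.hasDerivAt
  have heq : deriv (fdev τ p) =ᶠ[𝓝 z] fun w ↦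
      fdev τ p w * (2 * (oneTauPair τ hτ).derivWeierstrassP p /
        ((oneTauPair τ hτ).weierstrassP w - (oneTauPair τ hτ).weierstrassP p)) := by
    filter_upwards [eventually_notMem_lattice _ hz h1 h2] with w hw
    exact deriv_fdev hτ hp hw.1 hw.2.1 hw.2.2
  have hd := (hd0.mul ((hasDerivAt_const z (2 * (oneTauPair τ hτ).derivWeierstrassP p)).div
    (((oneTauPair τ hτ).hasDerivAt_weierstrassP hz).sub_const _) hD)).congr_of_eventuallyEq heq
  rw [hd.deriv, deriv_fdev hτ hp hz h1 h2]
  simp only [Pi.div_apply]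
  field_simp
  ring

theorem qpot_mul {τ p z : ℂ} (hτ : 0 < τ.im) (hp : 2 * p ∉ (oneTauPair τ hτ).lattice)
    (hz : z ∉ (oneTauPair τ hτ).lattice) (h1 : z + p ∉ (oneTauPair τ hτ).lattice)
    (h2 : z - p ∉ (oneTauPair τ hτ).lattice) :
    2 * qpot τ p (3 * wpdd τ p / (4 * wpd τ p)) z *
        ((oneTauPair τ hτ).weierstrassP z - (oneTauPair τ hτ).weierstrassP p) ^ 2 =
      2 * (oneTauPair τ hτ).derivWeierstrassP p ^ 2 - (oneTauPair τ hτ).derivWeierstrassP z ^ 2 / 2 +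
        (6 * (oneTauPair τ hτ).weierstrassP z ^ 2 - (oneTauPair τ hτ).g₂ / 2) *
          ((oneTauPair τ hτ).weierstrassP z - (oneTauPair τ hτ).weierstrassP p) := by
  set L := oneTauPair τ hτ
  have hpL := L.notMem_of_two_mul_notMem hp
  have hD := L.weierstrassP_sub_ne_zero hp hz h1 h2
  have hy := L.derivWeierstrassP_ne_zero hp
  have e1 : L.weierstrassZeta (z + p) - L.weierstrassZeta (z - p) = 2 * L.weierstrassZeta p -
      L.derivWeierstrassP p / (L.weierstrassP z - L.weierstrassP p) := by
    have := L.zetaDiff_mul hp hz h1 h2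
    rw [PeriodPair.zetaDiff] at this
    field_simp
    linear_combination this
  have e2 : L.weierstrassP (z + p) + L.weierstrassP (z - p) = 2 * L.weierstrassP p +
      (6 * L.weierstrassP p ^ 2 - L.g₂ / 2) / (L.weierstrassP z - L.weierstrassP p) +
      L.derivWeierstrassP p ^ 2 / (L.weierstrassP z - L.weierstrassP p) ^ 2 := by
    have h := L.weierstrassP_add_add_weierstrassP_sub hp hz h1 h2
    have h' := L.zetaDiff_mul hp hz h1 h2
    field_simp
    linear_combination -2 * (L.weierstrassP z - L.weierstrassP p) * h
      - 2 * L.derivWeierstrassP p * h'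
  have e3 : L.weierstrassZeta (2 * p) = 2 * L.weierstrassZeta p +
      (6 * L.weierstrassP p ^ 2 - L.g₂ / 2) / (2 * L.derivWeierstrassP p) := by
    have := L.weierstrassZeta_two_mul hp
    field_simp
    linear_combination 2 * this
  have e4 : L.weierstrassP (2 * p) = -2 * L.weierstrassP p +
      (6 * L.weierstrassP p ^ 2 - L.g₂ / 2) ^ 2 / (4 * L.derivWeierstrassP p ^ 2) := by
    have := L.weierstrassP_two_mul hp
    field_simp
    linear_combination 4 * this
  have c1 := L.derivWeierstrassP_sq z hz
  have c0 := L.derivWeierstrassP_sq p hpL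
  rw [qpot, Bc, wpd_eq_derivWeierstrassP hτ, wpdd_eq hτ hpL, wp_eq_weierstrassP hτ,
    wzeta_eq_weierstrassZeta hτ, e1, e2, e3, e4]
  generalize L.derivWeierstrassP p = y₀ at *
  generalize L.derivWeierstrassP z = y at *
  generalize L.weierstrassP p = x₀ at *
  generalize L.weierstrassP z = x at *
  rw [show 2 * x + 3 / 4 * (2 * x₀ + (6 * x₀ ^ 2 - L.g₂ / 2) / (x - x₀) + y₀ ^ 2 / (x - x₀) ^ 2) +
      3 * (6 * x₀ ^ 2 - L.g₂ / 2) / (4 * y₀) * (2 * L.weierstrassZeta p - y₀ / (x - x₀)) +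
      ((3 * (6 * x₀ ^ 2 - L.g₂ / 2) / (4 * y₀)) ^ 2 -
        (2 * L.weierstrassZeta p + (6 * x₀ ^ 2 - L.g₂ / 2) / (2 * y₀)) *
          (3 * (6 * x₀ ^ 2 - L.g₂ / 2) / (4 * y₀)) -
        3 / 4 * (-2 * x₀ + (6 * x₀ ^ 2 - L.g₂ / 2) ^ 2 / (4 * y₀ ^ 2)) - 2 * x₀) =
      2 * x + x₀ + 3 / 4 * y₀ ^ 2 / (x - x₀) ^ 2 by field_simp; ring]
  field_simp
  linear_combination 4 * c1 - 4 * c0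

/-- the Schwarzian derivative of `f` equals `−2 q(·; A₀)` with
`A₀ = 3℘''(p)/(4℘'(p))`, on `ℂ ∖ S` where `f' ≠ 0`. -/
theorem stmt_15 (τ p : ℂ) (hτ : 0 < τ.im) (hp : 2 * p ∉ Lam τ) :
    ∀ z ∉ Sset τ p, deriv (fdev τ p) z ≠ 0 →
      deriv (fun w => deriv (deriv (fdev τ p)) w / deriv (fdev τ p) w) z
          - 1 / 2 * (deriv (deriv (fdev τ p)) z / deriv (fdev τ p) z) ^ 2
        = -2 * qpot τ p (3 * wpdd τ p / (4 * wpd τ p)) z := by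
  intro z hzS _
  simp only [Sset, Set.mem_union, Set.mem_ofPred_eq, not_or, ← mem_oneTauPair_lattice hτ] at hzS hp
  obtain ⟨⟨hz, h2⟩, h1⟩ := hzS
  have hD := (oneTauPair τ hτ).weierstrassP_sub_ne_zero hp hz h1 h2
  have heq : (fun w ↦ deriv (deriv (fdev τ p)) w / deriv (fdev τ p) w) =ᶠ[𝓝 z] fun w ↦
      (2 * (oneTauPair τ hτ).derivWeierstrassP p - (oneTauPair τ hτ).derivWeierstrassP w) /
        ((oneTauPair τ hτ).weierstrassP w - (oneTauPair τ hτ).weierstrassP p) := by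
    filter_upwards [eventually_notMem_lattice _ hz h1 h2] with w hw
    exact deriv_deriv_fdev_div hτ hp hw.1 hw.2.1 hw.2.2
  have hd := ((((oneTauPair τ hτ).hasDerivAt_derivWeierstrassP hz).const_sub
    (2 * (oneTauPair τ hτ).derivWeierstrassP p)).div
      (((oneTauPair τ hτ).hasDerivAt_weierstrassP hz).sub_const
        ((oneTauPair τ hτ).weierstrassP p)) hD).congr_of_eventuallyEq heq
  rw [hd.deriv, deriv_deriv_fdev_div hτ hp hz h1 h2]
  have hq := qpot_mul hτ hp hz h1 h2
  field_simp
  linear_combination 2 * hq
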